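/- arXiv:1501.04419 — 4 statements merged into one kernel-verified Lean document; each statement's English description precedes it below -/
import Mathlib

section
/- Let S be a finite set, let 𝓛_m be a nonempty finite family of nonempty subsets of S (the maximal cliques), and let 𝓛 = {λ ⊆ S : λ ⊆ Λ for some Λ ∈ 𝓛_m}. For every constrained potential parametrisation (φ^λ)_{λ∈𝓛}, the energy U_φ(x) = Σ_{Λ∈𝓛_m} φ^{{s∈Λ : x_s = 1}} has a multilinear representation whose coefficients β^λ vanish for every λ ∉ 𝓛, and the linear map sending (φ^λ)_{λ∈𝓛} to the family (β^λ)_{λ∈𝓛} of multilinear coefficients of U_φ is a bijection from ℝ^𝓛 to ℝ^𝓛. -/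
open Finset

/-- The binary configuration `1^A`: equal to `1` on `A` and `0` elsewhere. -/
def indic {S : Type*} [DecidableEq S] (A : Finset S) : S → Fin 2 :=
  fun s => if s ∈ A then 1 else 0

/-- The energy of a constrained potential parametrisation `φ` relative to the family
of maximal cliques `Lm`: `U_φ(x) = Σ_{Λ ∈ Lm} φ^{{s ∈ Λ : x_s = 1}}`. -/
def energyPhi {S : Type*} [DecidableEq S] (Lm : Finset (Finset S))
    (φ : Finset S → ℝ) (x : S → Fin 2) : ℝ :=
  ∑ Λ ∈ Lm, φ (Λ.filter (fun s => x s = 1))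

/-- The multilinear coefficients of a pseudo-Boolean function `U`, given by Möbius
inversion: `β^λ = Σ_{A ⊆ λ} (-1)^{|λ|-|A|} U(1^A)`. -/
def mlCoeff {S : Type*} [DecidableEq S] (U : (S → Fin 2) → ℝ) (lam : Finset S) : ℝ :=
  ∑ A ∈ lam.powerset, (-1 : ℝ) ^ (lam.card - A.card) * U (indic A)

/-- The Möbius transform of a set function. -/
def moebiusTransform {S : Type*} (f : Finset S → ℝ) (lam : Finset S) : ℝ :=
  ∑ A ∈ lam.powerset, (-1 : ℝ) ^ (lam.card - A.card) * f A

/-- The number of members of `Lm` containing `lam`. -/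
def supersetCount {S : Type*} [DecidableEq S] (Lm : Finset (Finset S)) (lam : Finset S) : ℝ :=
  ((Lm.filter (fun Λ => lam ⊆ Λ)).card : ℝ)

lemma moebiusTransform_insert {S : Type*} [DecidableEq S] (f : Finset S → ℝ) {a : S}
    {lam : Finset S} (ha : a ∉ lam) :
    moebiusTransform f (insert a lam) =
      moebiusTransform (fun A => f (insert a A)) lam - moebiusTransform f lam := by
  unfold moebiusTransform
  rw [Finset.sum_powerset_insert ha, add_comm, sub_eq_add_neg, ← Finset.sum_neg_distrib]
  congr 1 <;> refine Finset.sum_congr rfl fun A hA => ?_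
  · have haA : a ∉ A := fun h => ha (Finset.mem_powerset.1 hA h)
    rw [Finset.card_insert_of_notMem ha, Finset.card_insert_of_notMem haA,
      Nat.add_sub_add_right]
  · have hc := Finset.card_le_card (Finset.mem_powerset.1 hA)
    rw [Finset.card_insert_of_notMem ha, Nat.sub_add_comm hc, pow_succ]
    ring

lemma sum_powerset_moebiusTransform {S : Type*} [DecidableEq S] (f : Finset S → ℝ)
    (B : Finset S) : ∑ lam ∈ B.powerset, moebiusTransform f lam = f B := by
  induction B using Finset.induction_on generalizing f with
  | empty => simp [moebiusTransform]
  | insert a B ha ih =>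
    rw [Finset.sum_powerset_insert ha, ← Finset.sum_add_distrib, ← ih fun A => f (insert a A)]
    refine Finset.sum_congr rfl fun lam hlam => ?_
    rw [moebiusTransform_insert f fun h => ha (Finset.mem_powerset.1 hlam h)]
    ring

lemma eq_of_sum_powerset_eq {S : Type*} [DecidableEq S] {g h : Finset S → ℝ} (B : Finset S)
    (H : ∀ A ⊆ B, ∑ lam ∈ A.powerset, g lam = ∑ lam ∈ A.powerset, h lam) : g B = h B := by
  induction B using Finset.strongInduction with
  | H B ih =>
    have hB := H B subset_rfl
    rw [← Finset.add_sum_erase _ g (Finset.mem_powerset_self B),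
      ← Finset.add_sum_erase _ h (Finset.mem_powerset_self B)] at hB
    have hlt : ∑ lam ∈ B.powerset.erase B, g lam = ∑ lam ∈ B.powerset.erase B, h lam := by
      refine Finset.sum_congr rfl fun A hA => ?_
      obtain ⟨hne, hA⟩ := Finset.mem_erase.1 hA
      have hAB := Finset.mem_powerset.1 hA
      exact ih A (hAB.ssubset_of_ne hne) fun C hC => H C (hC.trans hAB)
    linarith

lemma moebiusTransform_eq {S : Type*} [DecidableEq S] {f g : Finset S → ℝ} (B : Finset S)
    (H : ∀ A ⊆ B, f A = ∑ lam ∈ A.powerset, g lam) : moebiusTransform f B = g B :=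
  eq_of_sum_powerset_eq B fun A hA => (sum_powerset_moebiusTransform f A).trans (H A hA)

lemma sum_inter_eq_sum_powerset {S : Type*} [DecidableEq S] (Lm : Finset (Finset S))
    (φ : Finset S → ℝ) (A : Finset S) :
    ∑ Λ ∈ Lm, φ (Λ ∩ A) =
      ∑ lam ∈ A.powerset, supersetCount Lm lam * moebiusTransform φ lam := by
  have hinter (Λ : Finset S) : φ (Λ ∩ A) =
      ∑ lam ∈ A.powerset, if lam ⊆ Λ then moebiusTransform φ lam else 0 := by
    rw [← sum_powerset_moebiusTransform φ (Λ ∩ A), ← Finset.sum_filter]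
    refine Finset.sum_congr ?_ fun _ _ => rfl
    ext lam
    simp only [Finset.mem_powerset, Finset.mem_filter, Finset.subset_inter_iff, and_comm]
  simp_rw [hinter]
  rw [Finset.sum_comm]
  refine Finset.sum_congr rfl fun lam _ => ?_
  rw [← Finset.sum_filter, Finset.sum_const, nsmul_eq_mul, supersetCount]

lemma mlCoeff_energyPhi {S : Type*} [DecidableEq S] (Lm : Finset (Finset S))
    (φ : Finset S → ℝ) (lam : Finset S) :
    mlCoeff (energyPhi Lm φ) lam = supersetCount Lm lam * moebiusTransform φ lam := by
  refine moebiusTransform_eq (f := fun A => energyPhi Lm φ (indic A))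
    (g := fun lam => supersetCount Lm lam * moebiusTransform φ lam) lam fun A _ => ?_
  rw [← sum_inter_eq_sum_powerset]
  refine Finset.sum_congr rfl fun Λ _ => congrArg φ ?_
  ext s
  simp [indic]

lemma prod_binary_eq_ite {S : Type*} [Fintype S] [DecidableEq S] (x : S → Fin 2)
    (lam : Finset S) :
    ∏ s ∈ lam, ((x s : ℕ) : ℝ) =
      if lam ⊆ Finset.univ.filter (fun s => x s = 1) then 1 else 0 := by
  split_ifs with h
  · refine Finset.prod_eq_one fun s hs => ?_
    simp [(Finset.mem_filter.1 (h hs)).2]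
  · obtain ⟨s, hs, hxs⟩ := Finset.not_subset.1 h
    refine Finset.prod_eq_zero hs ?_
    have hx : x s ≠ 1 := by simpa using hxs
    have hx0 : x s = 0 := by omega
    simp [hx0]

theorem stmt0 {S : Type*} [Fintype S] [DecidableEq S]
    (Lm : Finset (Finset S)) (hLmne : Lm.Nonempty) (hne : ∀ Λ ∈ Lm, Λ.Nonempty)
    (L : Finset (Finset S)) (hL : ∀ lam, lam ∈ L ↔ ∃ Λ ∈ Lm, lam ⊆ Λ) :
    (∀ φ : Finset S → ℝ, ∃ β : Finset S → ℝ,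
        (∀ x : S → Fin 2,
          energyPhi Lm φ x = ∑ lam : Finset S, β lam * ∏ s ∈ lam, ((x s : ℕ) : ℝ)) ∧
        (∀ lam, lam ∉ L → β lam = 0)) ∧
    Function.Bijective
      (fun (φ : {lam : Finset S // lam ∈ L} → ℝ) (lam : {lam : Finset S // lam ∈ L}) =>
        mlCoeff (energyPhi Lm (fun μ => if h : μ ∈ L then φ ⟨μ, h⟩ else 0)) lam.1) := by
  have hcount (lam : Finset S) (h : lam ∈ L) : supersetCount Lm lam ≠ 0 := by
    obtain ⟨Λ, hΛ, hs⟩ := (hL lam).1 h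
    exact Nat.cast_ne_zero.2 (Finset.card_ne_zero_of_mem (Finset.mem_filter.2 ⟨hΛ, hs⟩))
  have hdown {A B : Finset S} (hB : B ∈ L) (hA : A ⊆ B) : A ∈ L := by
    obtain ⟨Λ, hΛ, hs⟩ := (hL B).1 hB
    exact (hL A).2 ⟨Λ, hΛ, hA.trans hs⟩
  refine ⟨fun φ => ⟨fun lam => supersetCount Lm lam * moebiusTransform φ lam,
    fun x => ?_, fun lam hlam => ?_⟩, fun φ ψ h => ?_, fun β => ?_⟩
  · have hfilter : energyPhi Lm φ x =
        ∑ Λ ∈ Lm, φ (Λ ∩ Finset.univ.filter (fun s => x s = 1)) := by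
      refine Finset.sum_congr rfl fun Λ _ => congrArg φ ?_
      ext s
      simp
    simp_rw [hfilter, sum_inter_eq_sum_powerset, prod_binary_eq_ite, mul_ite, mul_one, mul_zero]
    rw [← Finset.sum_filter]
    refine Finset.sum_congr ?_ fun _ _ => rfl
    ext lam
    simp only [Finset.mem_powerset, Finset.mem_filter, Finset.mem_univ, true_and]
  · have hempty : Lm.filter (fun Λ => lam ⊆ Λ) = ∅ :=
      Finset.filter_eq_empty_iff.2 fun Λ hΛ hs => hlam ((hL lam).2 ⟨Λ, hΛ, hs⟩)
    simp [supersetCount, hempty]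
  · funext ⟨B, hB⟩
    have hsum := Finset.sum_congr (rfl : B.powerset = B.powerset) fun lam hlam => by
      have hlamL := hdown hB (Finset.mem_powerset.1 hlam)
      have hcoeff := congrFun h ⟨lam, hlamL⟩
      simp only [mlCoeff_energyPhi] at hcoeff
      exact mul_left_cancel₀ (hcount lam hlamL) hcoeff
    simpa only [sum_powerset_moebiusTransform, hB, dite_true] using hsum
  · let g : Finset S → ℝ := fun lam =>
      if h : lam ∈ L then β ⟨lam, h⟩ / supersetCount Lm lam else 0
    refine ⟨fun B => ∑ lam ∈ B.1.powerset, g lam, ?_⟩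
    funext ⟨B, hB⟩
    have hg : moebiusTransform
        (fun A => if h : A ∈ L then ∑ lam ∈ A.powerset, g lam else 0) B = g B :=
      moebiusTransform_eq B fun A hA => dif_pos (hdown hB hA)
    simp only [mlCoeff_energyPhi, dite_eq_ite] at hg ⊢
    rw [hg]
    simp only [g, hB, dite_true]
    exact mul_div_cancel₀ _ (hcount B hB)
end

section
/- Let n, m ≥ 1, let S = (ℤ/nℤ) × (ℤ/mℤ) be the n×m torus lattice, fix a nonempty template Λ0 ⊆ S, and let 𝓛 = {λ ⊆ S : λ ⊆ Λ0 ⊕ (t,u) for some (t,u) ∈ S}. Let (β^λ)_{λ∈𝓛} be reals, define the energy U(x) = Σ_{λ∈𝓛} β^λ · Π_{s∈λ} x_s and the Gibbs distribution p(x) = exp(U(x)) / Σ_y exp(U(y)). Then p is stationary, i.e. p(1^A) = p(1^{A⊕(t,u)}) for all A ⊆ S and (t,u) ∈ S, if and only if β is translational invariant, i.e. β^λ = β^{λ⊕(t,u)} for all λ ∈ 𝓛 and (t,u) ∈ S. -/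
open Finset

/-- The translate `A ⊕ (t,u)` of a subset `A` of the torus lattice
`(ℤ/nℤ) × (ℤ/mℤ)` by a vector `v = (t,u)`. -/
def transl {n m : ℕ} (A : Finset (ZMod n × ZMod m)) (v : ZMod n × ZMod m) :
    Finset (ZMod n × ZMod m) :=
  A.image (fun p => p + v)

/-- The energy `U(x) = Σ_{λ ∈ L} β^λ · Π_{s ∈ λ} x_s` defined by interaction
parameters `β` over the family of cliques `L`. -/
def energyBeta {S : Type*} [DecidableEq S] (L : Finset (Finset S))
    (β : Finset S → ℝ) (x : S → Fin 2) : ℝ :=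
  ∑ lam ∈ L, β lam * ∏ s ∈ lam, ((x s : ℕ) : ℝ)

/-- The Gibbs distribution associated with an energy function `U`:
`p(x) = exp(U(x)) / Σ_y exp(U(y))`. -/
noncomputable def gibbs {S : Type*} [Fintype S] [DecidableEq S]
    (U : (S → Fin 2) → ℝ) (x : S → Fin 2) : ℝ :=
  Real.exp (U x) / ∑ y : S → Fin 2, Real.exp (U y)

theorem energyBeta_indic {S : Type*} [DecidableEq S] (L : Finset (Finset S))
    (β : Finset S → ℝ) (A : Finset S) :
    energyBeta L β (indic A) = ∑ B ∈ A.powerset, if B ∈ L then β B else 0 := by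
  have hprod (lam : Finset S) :
      ∏ s ∈ lam, ((indic A s : ℕ) : ℝ) = if lam ⊆ A then 1 else 0 := by
    split_ifs with h
    · exact Finset.prod_eq_one fun s hs => by simp [indic, h hs]
    · obtain ⟨s, hs, hsA⟩ := Finset.not_subset.mp h
      exact Finset.prod_eq_zero hs (by simp [indic, hsA])
  simp only [energyBeta, hprod, mul_ite, mul_one, mul_zero]
  rw [← Finset.sum_filter, ← Finset.sum_filter]
  exact Finset.sum_congr (by ext; simp [and_comm]) fun _ _ => rfl

/-- A set function is determined by its sums over powersets. -/
theorem sum_powerset_eq_iff {S M : Type*} [DecidableEq S] [AddCommGroup M]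
    (f g : Finset S → M) :
    (∀ A : Finset S, ∑ B ∈ A.powerset, f B = ∑ B ∈ A.powerset, g B) ↔ ∀ A, f A = g A := by
  refine ⟨fun h A => ?_, fun h A => Finset.sum_congr rfl fun B _ => h B⟩
  induction A using Finset.strongInduction with
  | H A ih =>
    have hA := h A
    rw [← Finset.add_sum_erase _ f (Finset.mem_powerset_self A),
      ← Finset.add_sum_erase _ g (Finset.mem_powerset_self A)] at hA
    have hs : ∑ B ∈ A.powerset.erase A, f B = ∑ B ∈ A.powerset.erase A, g B :=
      Finset.sum_congr rfl fun B hB => ih B <| by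
        rw [Finset.mem_erase, Finset.mem_powerset] at hB
        exact lt_of_le_of_ne hB.2 hB.1
    rwa [hs, add_left_inj] at hA

theorem sum_powerset_transl {n m : ℕ} {M : Type*} [AddCommMonoid M]
    (f : Finset (ZMod n × ZMod m) → M) (A : Finset (ZMod n × ZMod m)) (v : ZMod n × ZMod m) :
    ∑ B ∈ (transl A v).powerset, f B = ∑ B ∈ A.powerset, f (transl B v) := by
  unfold transl
  rw [Finset.powerset_image, Finset.sum_image]
  exact (Finset.image_injective (add_left_injective v)).injOn

theorem transl_subset_transl_add {n m : ℕ} {A B : Finset (ZMod n × ZMod m)}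
    {u : ZMod n × ZMod m} (h : A ⊆ transl B u) (v : ZMod n × ZMod m) :
    transl A v ⊆ transl B (u + v) := by
  have := Finset.image_subset_image (f := fun p => p + v) h
  simpa only [transl, Finset.image_image, Function.comp_def, add_assoc] using this

theorem transl_transl_neg {n m : ℕ} (A : Finset (ZMod n × ZMod m)) (v : ZMod n × ZMod m) :
    transl (transl A v) (-v) = A := by
  simp only [transl, Finset.image_image, Function.comp_def, add_neg_cancel_right, Finset.image_id']

theorem gibbs_eq_iff {S : Type*} [Fintype S] [DecidableEq S]
    (U : (S → Fin 2) → ℝ) (x y : S → Fin 2) : gibbs U x = gibbs U y ↔ U x = U y := by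
  have hZ : ∑ y : S → Fin 2, Real.exp (U y) ≠ 0 :=
    (Finset.sum_pos (fun y _ => Real.exp_pos (U y)) Finset.univ_nonempty).ne'
  rw [gibbs, gibbs, div_left_inj' hZ, Real.exp_eq_exp]

/-- On the `n × m` torus with cliques `L` generated by a nonempty template `Λ0`,
the Gibbs distribution of the energy `U(x) = Σ_{λ ∈ L} β^λ Π_{s∈λ} x_s` is stationary
if and only if `β` is translational invariant. -/
theorem stmt1 (n m : ℕ) [NeZero n] [NeZero m]
    (Λ0 : Finset (ZMod n × ZMod m)) (hΛ0 : Λ0.Nonempty)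
    (L : Finset (Finset (ZMod n × ZMod m)))
    (hL : ∀ lam : Finset (ZMod n × ZMod m),
      lam ∈ L ↔ ∃ v : ZMod n × ZMod m, lam ⊆ transl Λ0 v)
    (β : Finset (ZMod n × ZMod m) → ℝ) :
    (∀ (A : Finset (ZMod n × ZMod m)) (v : ZMod n × ZMod m),
        gibbs (energyBeta L β) (indic A) = gibbs (energyBeta L β) (indic (transl A v)))
      ↔ (∀ lam ∈ L, ∀ v : ZMod n × ZMod m, β lam = β (transl lam v)) := by
  have hmem (lam : Finset (ZMod n × ZMod m)) (v : ZMod n × ZMod m) :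
      transl lam v ∈ L ↔ lam ∈ L := by
    simp only [hL]
    constructor
    · rintro ⟨u, hu⟩
      exact ⟨u + -v, by simpa only [transl_transl_neg] using transl_subset_transl_add hu (-v)⟩
    · rintro ⟨u, hu⟩
      exact ⟨u + v, transl_subset_transl_add hu v⟩
  simp only [gibbs_eq_iff, energyBeta_indic, sum_powerset_transl, hmem]
  rw [forall_comm]
  simp only [sum_powerset_eq_iff]
  constructor
  · intro h lam hlam v
    simpa [hlam] using h v lam
  · intro h v lam
    split_ifs with hlam
    · exact h lam hlam v
    · rfl
end

section
/- Let S be a finite set and let U, U' be functions from binary configurations x : S → {0,1} to ℝ with multilinear representations (β^λ)_{λ⊆S} and (β'^λ)_{λ⊆S} respectively. If the associated Gibbs distributions coincide, i.e. exp(U(x)) / Σ_y exp(U(y)) = exp(U'(x)) / Σ_y exp(U'(y)) for every configuration x, then β^λ = β'^λ for every nonempty λ ⊆ S. In particular, fixing β^∅ = 0 makes the multilinear parametrisation of the Gibbs distribution identifiable. -/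
open Finset

/-- On the indicator of `A`, a multilinear polynomial is the sum of its coefficients
over the subsets of `A`. -/
theorem sum_mul_prod_indicator {S : Type*} [Fintype S] [DecidableEq S]
    (β : Finset S → ℝ) (A : Finset S) :
    ∑ lam : Finset S, β lam * ∏ s ∈ lam, (((if s ∈ A then 1 else 0 : Fin 2) : ℕ) : ℝ) =
      ∑ lam ∈ A.powerset, β lam := by
  have key : ∀ lam : Finset S,
      β lam * ∏ s ∈ lam, (((if s ∈ A then 1 else 0 : Fin 2) : ℕ) : ℝ) =
        if lam ∈ A.powerset then β lam else 0 := by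
    intro lam
    split_ifs with hl
    · rw [Finset.mem_powerset] at hl
      rw [Finset.prod_eq_one, mul_one]
      intro s hs
      simp [hl hs]
    · rw [Finset.mem_powerset, Finset.not_subset] at hl
      obtain ⟨s, hs, hsA⟩ := hl
      rw [Finset.prod_eq_zero hs (by simp [hsA]), mul_zero]
  rw [Finset.sum_congr rfl fun lam _ => key lam, Finset.sum_ite_mem, Finset.univ_inter]

/-- A set function whose sums over all power sets agree vanishes on nonempty sets. -/
theorem eq_zero_of_sum_powerset_eq {S : Type*} [DecidableEq S] (d : Finset S → ℝ) (c : ℝ)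
    (hd : ∀ A : Finset S, ∑ lam ∈ A.powerset, d lam = c) (A : Finset S) (hA : A.Nonempty) :
    d A = 0 := by
  induction A using Finset.strongInduction with
  | H A ih =>
    have h_empty : d ∅ = c := by simpa using hd ∅
    have h_ssubsets : ∑ lam ∈ A.ssubsets, d lam = d ∅ := by
      refine Finset.sum_eq_single_of_mem ∅ (Finset.mem_ssubsets.2 hA.empty_ssubset) ?_
      intro lam hl hne
      exact ih lam (Finset.mem_ssubsets.1 hl) (Finset.nonempty_iff_ne_empty.2 hne)
    have h_total := Finset.add_sum_erase A.powerset d (Finset.mem_powerset_self A)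
    change d A + ∑ lam ∈ A.ssubsets, d lam = _ at h_total
    linarith [hd A]

/-- Energies with the same Gibbs distribution differ by a constant. -/
theorem sub_eq_log_sub_log_of_gibbs_eq {S : Type*} [Fintype S] [DecidableEq S]
    {U U' : (S → Fin 2) → ℝ} {x : S → Fin 2} (hx : gibbs U x = gibbs U' x) :
    U x - U' x =
      Real.log (∑ y, Real.exp (U y)) - Real.log (∑ y, Real.exp (U' y)) := by
  have hpos : ∀ V : (S → Fin 2) → ℝ, ∑ y, Real.exp (V y) ≠ 0 := fun V =>
    (Finset.sum_pos (fun y _ => Real.exp_pos (V y)) Finset.univ_nonempty).ne'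
  have hlog := congrArg Real.log hx
  rw [gibbs, gibbs, Real.log_div (Real.exp_ne_zero _) (hpos U),
    Real.log_div (Real.exp_ne_zero _) (hpos U'), Real.log_exp, Real.log_exp] at hlog
  linarith

/-- If two energy functions with multilinear representations `β` and `β'` define the
same Gibbs distribution, then `β^λ = β'^λ` for every nonempty `λ ⊆ S`; i.e. the
multilinear parametrisation of the Gibbs distribution is identifiable once `β^∅` is
fixed. -/
theorem stmt6 {S : Type*} [Fintype S] [DecidableEq S]
    (U U' : (S → Fin 2) → ℝ) (β β' : Finset S → ℝ)
    (h : ∀ x : S → Fin 2, U x = ∑ lam : Finset S, β lam * ∏ s ∈ lam, ((x s : ℕ) : ℝ))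
    (h' : ∀ x : S → Fin 2, U' x = ∑ lam : Finset S, β' lam * ∏ s ∈ lam, ((x s : ℕ) : ℝ))
    (hp : ∀ x : S → Fin 2, gibbs U x = gibbs U' x) :
    ∀ lam : Finset S, lam.Nonempty → β lam = β' lam := by
  intro lam hlam
  refine sub_eq_zero.1 (eq_zero_of_sum_powerset_eq (fun A => β A - β' A)
    (Real.log (∑ y, Real.exp (U y)) - Real.log (∑ y, Real.exp (U' y))) ?_ lam hlam)
  intro A
  rw [Finset.sum_sub_distrib, ← sum_mul_prod_indicator β A, ← sum_mul_prod_indicator β' A,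
    ← h fun s => if s ∈ A then 1 else 0, ← h' fun s => if s ∈ A then 1 else 0]
  exact sub_eq_log_sub_log_of_gibbs_eq (hp _)
end

section
/- Let n, m ≥ 2, let S = (ℤ/nℤ) × (ℤ/mℤ), and let ω, η ∈ ℝ. Define f : {0,1}^4 → ℝ by f(a,b,c,d) = η if a = b = c = d; f(a,b,c,d) = η − 2ω if a = d, b = c and a ≠ b; and f(a,b,c,d) = η − ω otherwise. Then for every binary configuration x : S → {0,1} (index arithmetic modulo n and m), Σ_{(t,u)∈S} f( x_{t,u}, x_{t+1,u}, x_{t,u+1}, x_{t+1,u+1} ) = n·m·η − ω Σ_{(i,j)∈S} [ 𝟙(x_{i,j} ≠ x_{i+1,j}) + 𝟙(x_{i,j} ≠ x_{i,j+1}) ]. That is, the Ising energy with torus boundary conditions is, up to the additive constant n·m·η, realised by 2×2 maximal-clique potentials that assign potential η to constant blocks, η − 2ω to the two diagonal (checkerboard) block patterns, and η − ω to all other block patterns. -/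
open Finset

/-- The 2×2 maximal-clique potential realising the Ising model: potential `η` for
constant blocks, `η − 2ω` for the two diagonal (checkerboard) block patterns, and
`η − ω` for all other block patterns. -/
def isingBlock (η ω : ℝ) (a b c d : Fin 2) : ℝ :=
  if a = b ∧ b = c ∧ c = d then η
  else if a = d ∧ b = c ∧ a ≠ b then η - 2 * ω
  else η - ω

/-- The block potential is `η` minus `ω / 2` times the number of disagreeing edges
of the block. -/
theorem isingBlock_eq (η ω : ℝ) (a b c d : Fin 2) :
    isingBlock η ω a b c d
      = η - ω / 2 * (((if a ≠ b then (1 : ℝ) else 0) + (if a ≠ c then (1 : ℝ) else 0))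
          + ((if c ≠ d then (1 : ℝ) else 0) + (if b ≠ d then (1 : ℝ) else 0))) := by
  unfold isingBlock
  fin_cases a <;> fin_cases b <;> fin_cases c <;> fin_cases d <;> norm_num <;> ring

/-- On the `n × m` torus (`n, m ≥ 2`), summing the 2×2 block potentials `isingBlock`
over all blocks yields the Ising energy with torus boundary conditions up to the
additive constant `n·m·η`. -/
theorem stmt9 (n m : ℕ) [NeZero n] [NeZero m] (hn : 2 ≤ n) (hm : 2 ≤ m)
    (η ω : ℝ) (x : ZMod n × ZMod m → Fin 2) :
    (∑ p : ZMod n × ZMod m,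
        isingBlock η ω (x p) (x (p.1 + 1, p.2)) (x (p.1, p.2 + 1))
          (x (p.1 + 1, p.2 + 1)))
      = (n : ℝ) * (m : ℝ) * η
        - ω * ∑ p : ZMod n × ZMod m,
            ((if x p ≠ x (p.1 + 1, p.2) then (1 : ℝ) else 0) +
              (if x p ≠ x (p.1, p.2 + 1) then (1 : ℝ) else 0)) := by
  have h₁ : ∑ p : ZMod n × ZMod m,
        (if x (p.1, p.2 + 1) ≠ x (p.1 + 1, p.2 + 1) then (1 : ℝ) else 0)
      = ∑ p : ZMod n × ZMod m, (if x p ≠ x (p.1 + 1, p.2) then (1 : ℝ) else 0) :=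
    Fintype.sum_equiv ((Equiv.refl _).prodCongr (Equiv.addRight 1)) _ _ fun _ => rfl
  have h₂ : ∑ p : ZMod n × ZMod m,
        (if x (p.1 + 1, p.2) ≠ x (p.1 + 1, p.2 + 1) then (1 : ℝ) else 0)
      = ∑ p : ZMod n × ZMod m, (if x p ≠ x (p.1, p.2 + 1) then (1 : ℝ) else 0) :=
    Fintype.sum_equiv ((Equiv.addRight 1).prodCongr (Equiv.refl _)) _ _ fun _ => rfl
  simp only [isingBlock_eq, sum_sub_distrib, ← mul_sum, sum_add_distrib, h₁, h₂, sum_const,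
    card_univ, Fintype.card_prod, ZMod.card, nsmul_eq_mul, Nat.cast_mul]
  ring
end
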